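/- arXiv:1607.03969 — 5 statements merged into one kernel-verified Lean document; each statement's English description precedes it below -/
import Mathlib

section
/- Let p be a square-free bivariate polynomial over ℂ of total degree n ≥ 1. Then there exist matrices A, B, C ∈ ℂ^{n×n} such that det(A + xB + yC) = p(x,y) as an identity of bivariate polynomials. -/
open Polynomial

theorem det_hessenberg_lastRow {R : Type*} [CommRing R] (M : ℕ → ℕ → R) (y : R)
    (h1 : ∀ i, M i (i + 1) = -y) (h2 : ∀ i j, i + 1 < j → M i j = 0) (m : ℕ) (r : ℕ → R) :
    (Matrix.of fun i j : Fin (m + 1) => if (i : ℕ) = m then r j else M i j).det =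
      ∑ k ∈ Finset.range (m + 1),
        r k * y ^ (m - k) * (Matrix.of fun i j : Fin k => M i j).det := by
  induction m with
  | zero => simp
  | succ m ih =>
    rw [Matrix.det_succ_column _ (Fin.last (m + 1)), Fin.sum_univ_castSucc,
      Fin.sum_univ_castSucc, Finset.sum_eq_zero]
    · rw [Finset.sum_range_succ _ (m + 1), zero_add]
      congr 1
      · have hsub : ((Matrix.of fun i j : Fin (m + 1 + 1) =>
            if (i : ℕ) = m + 1 then r j else M i j).submatrix
            ((Fin.last m).castSucc).succAbove (Fin.last (m + 1)).succAbove) =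
            Matrix.of fun i j : Fin (m + 1) => if (i : ℕ) = m then r j else M i j := by
          ext i j
          rcases Fin.eq_castSucc_or_eq_last i with ⟨i, rfl⟩ | rfl
          · have : (i : ℕ) ≠ m + 1 := by omega
            have h' : (i : ℕ) ≠ m := by omega
            simp [Fin.succAbove, Fin.lt_def, this, h']
          · simp [Fin.succAbove]
        rw [hsub, ih, Finset.mul_sum]
        refine Finset.sum_congr rfl fun k hk => ?_
        have hk' : m + 1 - k = (m - k) + 1 := by
          have := Finset.mem_range.1 hk
          omega
        have hs : (-1 : R) ^ (m + (m + 1)) = -1 := Odd.neg_one_pow ⟨m, by ring⟩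
        simp only [Matrix.of_apply, Fin.val_castSucc, Fin.val_last, h1, hk', hs,
          Nat.ne_of_lt (Nat.lt_succ_self m), if_false, Nat.succ_eq_add_one]
        ring
      · have hsub : ((Matrix.of fun i j : Fin (m + 1 + 1) =>
            if (i : ℕ) = m + 1 then r j else M i j).submatrix
            (Fin.last (m + 1)).succAbove (Fin.last (m + 1)).succAbove) =
            Matrix.of fun i j : Fin (m + 1) => M i j := by
          ext i j
          have : (i : ℕ) ≠ m + 1 := by omega
          simp [this]
        rw [hsub]
        simp [← two_mul]
    · intro i _
      have : (i : ℕ) ≠ m + 1 := by omega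
      simp [this, h2 i (m + 1) (by omega)]

theorem det_hessenberg {R : Type*} [CommRing R] (M : ℕ → ℕ → R) (y : R)
    (h1 : ∀ i, M i (i + 1) = -y) (h2 : ∀ i j, i + 1 < j → M i j = 0) (m : ℕ) :
    (Matrix.of fun i j : Fin (m + 1) => M i j).det =
      ∑ k ∈ Finset.range (m + 1),
        M m k * y ^ (m - k) * (Matrix.of fun i j : Fin k => M i j).det := by
  rw [← det_hessenberg_lastRow M y h1 h2 m (M m)]
  congr 1
  ext i j
  by_cases h : (i : ℕ) = m <;> simp [h]

section Pencil

variable {K : Type*} [Field K]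

/-- The polynomials in `y` with coefficients in `K[x]` of total degree at most `m`. -/
def TotalDegreeLE (m : ℕ) (P : K[X][X]) : Prop :=
  ∀ i j, m < i + j → (P.coeff j).coeff i = 0

theorem TotalDegreeLE.mono {m k : ℕ} {P : K[X][X]} (h : TotalDegreeLE m P) (hmk : m ≤ k) :
    TotalDegreeLE k P := fun i j hij => h i j (by omega)

theorem TotalDegreeLE.add {m : ℕ} {P Q : K[X][X]} (hP : TotalDegreeLE m P)
    (hQ : TotalDegreeLE m Q) : TotalDegreeLE m (P + Q) := fun i j hij => by
  simp [hP i j hij, hQ i j hij]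

theorem TotalDegreeLE.sub {m : ℕ} {P Q : K[X][X]} (hP : TotalDegreeLE m P)
    (hQ : TotalDegreeLE m Q) : TotalDegreeLE m (P - Q) := fun i j hij => by
  simp [hP i j hij, hQ i j hij]

theorem TotalDegreeLE.sum {ι : Type*} {m : ℕ} (s : Finset ι) {f : ι → K[X][X]}
    (h : ∀ i ∈ s, TotalDegreeLE m (f i)) : TotalDegreeLE m (∑ i ∈ s, f i) := fun i j hij => by
  rw [finsetSum_coeff, finsetSum_coeff]
  exact Finset.sum_eq_zero fun k hk => h k hk i j hij

theorem TotalDegreeLE.mul {m k : ℕ} {P Q : K[X][X]} (hP : TotalDegreeLE m P)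
    (hQ : TotalDegreeLE k Q) : TotalDegreeLE (m + k) (P * Q) := fun i j hij => by
  rw [coeff_mul, finsetSum_coeff]
  refine Finset.sum_eq_zero fun a ha => ?_
  rw [coeff_mul]
  refine Finset.sum_eq_zero fun b hb => ?_
  rw [Finset.HasAntidiagonal.mem_antidiagonal] at ha hb
  rcases lt_or_ge m (b.1 + a.1) with h | h
  · rw [hP _ _ h, zero_mul]
  · rw [hQ b.2 a.2 (by omega), mul_zero]

theorem totalDegreeLE_C_C (m : ℕ) (a : K) : TotalDegreeLE m (C (C a)) := fun i j hij => by
  rcases eq_or_ne j 0 with rfl | hj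
  · rw [coeff_C_zero, coeff_C_of_ne_zero (by omega)]
  · rw [coeff_C_of_ne_zero hj, coeff_zero]

theorem totalDegreeLE_X : TotalDegreeLE 1 (X : K[X][X]) := fun i j hij => by
  rw [coeff_X]
  split_ifs with h
  · rw [coeff_one, if_neg (by omega)]
  · simp

theorem totalDegreeLE_C_X : TotalDegreeLE 1 (C X : K[X][X]) := fun i j hij => by
  rcases eq_or_ne j 0 with rfl | hj
  · rw [coeff_C_zero, coeff_X, if_neg (by omega)]
  · rw [coeff_C_of_ne_zero hj, coeff_zero]

theorem TotalDegreeLE.pow {m : ℕ} {P : K[X][X]} (hP : TotalDegreeLE m P) (k : ℕ) :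
    TotalDegreeLE (k * m) (P ^ k) := by
  induction k with
  | zero => simpa using totalDegreeLE_C_C 0 (1 : K)
  | succ k ih => simpa [pow_succ, add_mul] using ih.mul hP

/-- The entries of the lower Hessenberg pencil with diagonal `x - c i + y b i i`, entries `y b i j`
below the diagonal and `-y` on the superdiagonal. -/
noncomputable def pencilEntry (c : ℕ → K) (b : ℕ → ℕ → K) (i j : ℕ) : K[X][X] :=
  if i = j then C (X - C (c i)) + C (C (b i j)) * X
  else if j < i then C (C (b i j)) * X
  else if j = i + 1 then -X else 0

/-- The leading principal minor of order `m` of the pencil `pencilEntry c b`. -/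
noncomputable def pencilDet (c : ℕ → K) (b : ℕ → ℕ → K) (m : ℕ) : K[X][X] :=
  (Matrix.of fun i j : Fin m => pencilEntry c b i j).det

theorem pencilDet_zero (c : ℕ → K) (b : ℕ → ℕ → K) : pencilDet c b 0 = 1 := by
  simp [pencilDet]

theorem pencilDet_succ (c : ℕ → K) (b : ℕ → ℕ → K) (m : ℕ) :
    pencilDet c b (m + 1) = C (X - C (c m)) * pencilDet c b m +
      ∑ k ∈ Finset.range (m + 1), C (C (b m k)) * X ^ (m + 1 - k) * pencilDet c b k := by
  refine (det_hessenberg (pencilEntry c b) X ?_ ?_ m).trans ?_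
  · intro i
    rw [pencilEntry, if_neg (by omega), if_neg (by omega), if_pos rfl]
  · intro i j hij
    rw [pencilEntry, if_neg (by omega), if_neg (by omega), if_neg (by omega)]
  · rw [Finset.sum_range_succ, Finset.sum_range_succ, add_left_comm]
    refine congrArg₂ (· + ·) ?_ ?_
    · refine Finset.sum_congr rfl fun k hk => ?_
      rw [Finset.mem_range] at hk
      rw [pencilEntry, if_neg (by omega), if_pos hk, show m + 1 - k = (m - k) + 1 by omega,
        pencilDet]
      ring
    · simp [pencilEntry, pencilDet]
      ring

theorem totalDegreeLE_pencilDet (c : ℕ → K) (b : ℕ → ℕ → K) (m : ℕ) :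
    TotalDegreeLE m (pencilDet c b m) := by
  induction m using Nat.strong_induction_on with
  | _ m ih =>
    cases m with
    | zero => simpa [pencilDet_zero] using totalDegreeLE_C_C 0 (1 : K)
    | succ m =>
      rw [pencilDet_succ]
      refine .add ?_ (.sum _ fun k hk => ?_)
      · rw [add_comm m, C_sub]
        exact (totalDegreeLE_C_X.sub (totalDegreeLE_C_C _ _)).mul (ih m (by omega))
      · rw [Finset.mem_range] at hk
        exact (((totalDegreeLE_C_C 0 _).mul (totalDegreeLE_X.pow _)).mul (ih k hk)).mono (by omega)

theorem X_dvd_pencilDet_sub (c : ℕ → K) (b : ℕ → ℕ → K) (m : ℕ) :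
    X ∣ pencilDet c b m - C (∏ i ∈ Finset.range m, (X - C (c i))) := by
  induction m with
  | zero => simp [pencilDet_zero]
  | succ m ih =>
    have hs : X ∣ ∑ k ∈ Finset.range (m + 1),
        C (C (b m k)) * X ^ (m + 1 - k) * pencilDet c b k := by
      refine Finset.dvd_sum fun k hk => ?_
      rw [Finset.mem_range] at hk
      exact ((dvd_pow_self _ (by omega)).mul_left _).mul_right _
    rw [pencilDet_succ, Finset.prod_range_succ, C_mul]
    convert (ih.mul_left (C (X - C (c m)))).add hs using 1
    ring

/-- The first-order change of `pencilDet c b m` when `δ` is added to the `d`-th subdiagonal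
of `b`. -/
noncomputable def pencilVariation (c : ℕ → K) (d : ℕ) (δ : ℕ → K) : ℕ → K[X]
  | 0 => 0
  | m + 1 => (X - C (c m)) * pencilVariation c d δ m +
      if d ≤ m then C (δ m) * ∏ i ∈ Finset.range (m - d), (X - C (c i)) else 0

theorem pencilVariation_congr (c : ℕ → K) (d : ℕ) {δ δ' : ℕ → K} (m : ℕ)
    (h : ∀ i < m, δ i = δ' i) : pencilVariation c d δ m = pencilVariation c d δ' m := by
  induction m with
  | zero => rfl
  | succ m ih =>
    rw [pencilVariation, pencilVariation, ih fun i hi => h i (by omega), h m (by omega)]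

theorem X_pow_dvd_pencilDet_variation (c : ℕ → K) (b : ℕ → ℕ → K) (d : ℕ) (δ : ℕ → K) (m : ℕ) :
    X ^ (d + 2) ∣ pencilDet c (fun i j => b i j + if i = j + d then δ i else 0) m -
      pencilDet c b m - X ^ (d + 1) * C (pencilVariation c d δ m) := by
  induction m using Nat.strong_induction_on with
  | _ m ih =>
    cases m with
    | zero => simp [pencilDet_zero, pencilVariation]
    | succ m =>
      set b' : ℕ → ℕ → K := fun i j => b i j + if i = j + d then δ i else 0 with hb'
      have hdiff : X ^ (d + 2) ∣ ∑ k ∈ Finset.range (m + 1),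
          C (C (b' m k)) * X ^ (m + 1 - k) * (pencilDet c b' k - pencilDet c b k) := by
        refine Finset.dvd_sum fun k hk => ?_
        rw [Finset.mem_range] at hk
        have h1 : X ^ (d + 1) ∣ pencilDet c b' k - pencilDet c b k := by
          have := (dvd_sub_left (dvd_mul_right (X ^ (d + 1)) _)).1
            ((pow_dvd_pow X (by omega : d + 1 ≤ d + 2)).trans (ih k hk))
          exact this
        rw [show d + 2 = 1 + (d + 1) by omega, pow_add, pow_one]
        exact mul_dvd_mul ((dvd_pow_self _ (by omega)).mul_left _) h1
      have hsum : X ^ (d + 2) ∣ (∑ k ∈ Finset.range (m + 1),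
          C (C (if m = k + d then δ m else 0)) * X ^ (m + 1 - k) * pencilDet c b k) -
          X ^ (d + 1) *
            C (if d ≤ m then C (δ m) * ∏ i ∈ Finset.range (m - d), (X - C (c i)) else 0) := by
        split_ifs with hd
        · rw [Finset.sum_eq_single (m - d)]
          · rw [if_pos (by omega), show m + 1 - (m - d) = d + 1 by omega, C_mul,
              mul_comm (C (C (δ m))), mul_assoc, ← mul_sub, ← mul_sub, pow_succ X (d + 1)]
            exact mul_dvd_mul_left _ ((X_dvd_pencilDet_sub c b _).mul_left _)
          · intro k _ hk
            rw [if_neg (by omega)]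
            simp
          · intro h
            exact absurd (Finset.mem_range.2 (by omega)) h
        · rw [Finset.sum_eq_zero]
          · simp
          · intro k _
            rw [if_neg (by omega)]
            simp
      rw [pencilDet_succ, pencilDet_succ, pencilVariation]
      convert (((ih m (by omega)).mul_left (C (X - C (c m)))).add hdiff).add hsum using 1
      have key : ∑ k ∈ Finset.range (m + 1), C (C (b' m k)) * X ^ (m + 1 - k) * pencilDet c b' k
          - ∑ k ∈ Finset.range (m + 1), C (C (b m k)) * X ^ (m + 1 - k) * pencilDet c b k =
          ∑ k ∈ Finset.range (m + 1),
            C (C (b' m k)) * X ^ (m + 1 - k) * (pencilDet c b' k - pencilDet c b k) +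
          ∑ k ∈ Finset.range (m + 1),
            C (C (if m = k + d then δ m else 0)) * X ^ (m + 1 - k) * pencilDet c b k := by
        rw [← Finset.sum_sub_distrib, ← Finset.sum_add_distrib]
        refine Finset.sum_congr rfl fun k _ => ?_
        simp only [hb', C_add]
        ring
      rw [C_add, C_mul]
      linear_combination key

theorem exists_pencilVariation_eq (c : ℕ → K) (d n : ℕ) (hc : Set.InjOn c (Set.Iio n))
    (f : K[X]) (hf : f.degree < ((n - d : ℕ) : WithBot ℕ)) :
    ∃ δ, pencilVariation c d δ n = f := by
  induction n generalizing f with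
  | zero =>
    refine ⟨0, ?_⟩
    rw [Nat.zero_sub, Nat.cast_zero, Nat.WithBot.lt_zero_iff, degree_eq_bot] at hf
    rw [hf, pencilVariation]
  | succ n ih =>
    have hc' : Set.InjOn c (Set.Iio n) := hc.mono (Set.Iio_subset_Iio (Nat.le_succ n))
    by_cases hd : d ≤ n
    · set P : K[X] := ∏ i ∈ Finset.range (n - d), (X - C (c i)) with hP
      have hP0 : P.eval (c n) ≠ 0 := by
        rw [hP, eval_prod, Finset.prod_ne_zero_iff]
        intro i hi h
        rw [Finset.mem_range] at hi
        rw [eval_sub, eval_X, eval_C, sub_eq_zero] at h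
        have := hc (Set.mem_Iio.2 (Nat.lt_succ_self n)) (Set.mem_Iio.2 (by omega)) h
        omega
      have hPdeg : P.degree = ((n - d : ℕ) : WithBot ℕ) := by
        rw [hP, degree_prod]
        simp
      set e : K := f.eval (c n) / P.eval (c n)
      have hroot : (f - C e * P).IsRoot (c n) := by
        simp [IsRoot, e, hP0]
      obtain ⟨g, hg⟩ := dvd_iff_isRoot.2 hroot
      have hgdeg : g.degree < ((n - d : ℕ) : WithBot ℕ) := by
        have h1 : (f - C e * P).degree < ((n - d + 1 : ℕ) : WithBot ℕ) := by
          rw [degree_lt_iff_coeff_zero]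
          intro j hj
          rw [coeff_sub, coeff_C_mul, coeff_eq_zero_of_degree_lt (p := P),
            coeff_eq_zero_of_degree_lt (p := f), mul_zero, sub_zero]
          · exact hf.trans_le (by exact_mod_cast (by omega : n + 1 - d ≤ j))
          · rw [hPdeg]
            exact_mod_cast (by omega : n - d < j)
        rw [hg, degree_mul, degree_X_sub_C] at h1
        rcases eq_or_ne g 0 with rfl | hg0
        · simp
        · rw [degree_eq_natDegree hg0] at h1 ⊢
          norm_cast at h1 ⊢
          omega
      obtain ⟨δ, hδ⟩ := ih hc' g hgdeg
      refine ⟨Function.update δ n e, ?_⟩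
      rw [pencilVariation, if_pos hd, Function.update_self,
        pencilVariation_congr c d (δ' := δ) n
          (fun i hi => Function.update_of_ne (by omega) _ _), hδ, ← hg]
      ring
    · have hf0 : f = 0 := by
        rwa [show n + 1 - d = 0 by omega, Nat.cast_zero, Nat.WithBot.lt_zero_iff, degree_eq_bot] at hf
      obtain ⟨δ, hδ⟩ := ih hc' 0 (by simp)
      exact ⟨δ, by rw [pencilVariation, hδ, if_neg hd, hf0, mul_zero, zero_add]⟩

theorem exists_pencilDet_eq (c : ℕ → K) (n : ℕ) (hc : Set.InjOn c (Set.Iio n)) (P : K[X][X])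
    (hP : TotalDegreeLE n P) (hP0 : P.coeff 0 = ∏ i ∈ Finset.range n, (X - C (c i))) :
    ∃ b, pencilDet c b n = P := by
  have approx : ∀ d : ℕ, ∃ b, X ^ (d + 1) ∣ pencilDet c b n - P := by
    intro d
    induction d with
    | zero =>
      refine ⟨0, ?_⟩
      have h := X_dvd_pencilDet_sub c 0 n
      rw [X_dvd_iff, coeff_sub, coeff_C_zero] at h
      rw [zero_add, pow_one, X_dvd_iff, coeff_sub, hP0, h]
    | succ d ih =>
      obtain ⟨b, hb⟩ := ih
      have htd := hP.sub (totalDegreeLE_pencilDet c b n)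
      obtain ⟨δ, hδ⟩ := exists_pencilVariation_eq c d n hc ((P - pencilDet c b n).coeff (d + 1)) (by
        rw [degree_lt_iff_coeff_zero]
        intro j hj
        exact htd _ _ (by omega))
      have hrest : X ^ (d + 2) ∣ P - pencilDet c b n -
          X ^ (d + 1) * C ((P - pencilDet c b n).coeff (d + 1)) := by
        rw [X_pow_dvd_iff]
        intro j hj
        rw [coeff_sub, coeff_X_pow_mul']
        rcases (by omega : j = d + 1 ∨ j < d + 1) with rfl | hj'
        · simp
        · rw [if_neg (by omega), sub_zero, ← neg_sub, coeff_neg, X_pow_dvd_iff.1 hb j hj', neg_zero]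
      refine ⟨fun i j => b i j + if i = j + d then δ i else 0, ?_⟩
      have h := (X_pow_dvd_pencilDet_variation c b d δ n).sub hrest
      rw [hδ] at h
      convert h using 1
      ring
  obtain ⟨b, hb⟩ := approx n
  refine ⟨b, sub_eq_zero.1 ?_⟩
  ext j i
  rcases le_or_gt j n with hj | hj
  · rw [X_pow_dvd_iff.1 hb j (by omega), coeff_zero, coeff_zero, coeff_zero]
  · exact ((totalDegreeLE_pencilDet c b n).sub hP) i j (by omega)

end Pencil

theorem squarefree_map_of_monic {R : Type*} [CommRing R] [IsDomain R] [IsIntegrallyClosed R]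
    (L : Type*) [Field L] [Algebra R L] [IsFractionRing R L] {q : R[X]} (hq : q.Monic)
    (hsf : Squarefree q) : Squarefree (q.map (algebraMap R L)) := by
  intro g hg
  obtain ⟨g', hg'⟩ := IsIntegrallyClosed.eq_map_mul_C_of_dvd L hq ((dvd_mul_right g g).trans hg)
  have hg0 : g ≠ 0 := by
    rintro rfl
    rw [zero_mul, zero_dvd_iff] at hg
    exact (hq.map (algebraMap R L)).ne_zero hg
  have hu : IsUnit (C g.leadingCoeff) := isUnit_C.2 (leadingCoeff_ne_zero.2 hg0).isUnit
  have hinj : Function.Injective (algebraMap R L) := IsFractionRing.injective R L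
  have hmon : g'.Monic := by
    have : (g'.map (algebraMap R L)).Monic := by
      have h := congrArg leadingCoeff hg'
      rw [leadingCoeff_mul, leadingCoeff_C] at h
      exact mul_right_cancel₀ (leadingCoeff_ne_zero.2 hg0) (h.trans (one_mul _).symm)
    exact hinj.monic_map_iff.2 this
  have hdvd : g' * g' ∣ q := by
    rw [← map_dvd_map _ hinj (hmon.mul hmon), Polynomial.map_mul]
    have h : g'.map (algebraMap R L) ∣ g := Dvd.intro _ hg'
    exact (mul_dvd_mul h h).trans hg
  rw [← hg']
  exact ((hsf g' hdvd).map (mapRingHom (algebraMap R L))).mul hu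

theorem exists_separable_specialization {K : Type*} [Field K] [CharZero K] {q : K[X][X]}
    (hq : q.Monic) (hsf : Squarefree q) :
    ∃ a : K, (q.map (evalRingHom a)).Separable := by
  obtain ⟨u, v, huv⟩ := PerfectField.separable_iff_squarefree.2
    (squarefree_map_of_monic (FractionRing K[X]) hq hsf)
  obtain ⟨r, hr, hu⟩ := IsLocalization.integerNormalization_spec (nonZeroDivisors K[X]) u
  obtain ⟨s, hs, hv⟩ := IsLocalization.integerNormalization_spec (nonZeroDivisors K[X]) v
  generalize IsLocalization.integerNormalization (nonZeroDivisors K[X]) u = U at hu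
  generalize IsLocalization.integerNormalization (nonZeroDivisors K[X]) v = V at hv
  have hbezout : C s * U * q + C r * V * derivative q = C (r * s) := by
    apply map_injective _ (IsFractionRing.injective K[X] (FractionRing K[X]))
    simp only [Polynomial.map_add, Polynomial.map_mul, map_C, hu, hv, ← derivative_map,
      Algebra.smul_def, IsScalarTower.algebraMap_apply K[X] (FractionRing K[X])
      (FractionRing K[X])[X], algebraMap_eq, map_mul]
    linear_combination C (algebraMap K[X] (FractionRing K[X]) r) *
      C (algebraMap K[X] (FractionRing K[X]) s) * huv
  have hrs : r * s ≠ 0 := nonZeroDivisors.ne_zero (mul_mem hr hs)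
  obtain ⟨a, ha⟩ : ∃ a, (r * s).eval a ≠ 0 := by
    by_contra! h
    exact hrs (Polynomial.funext fun a => by rw [h a, eval_zero])
  have hspec := congrArg (map (evalRingHom a)) hbezout
  simp only [Polynomial.map_add, Polynomial.map_mul, map_C, ← derivative_map,
    coe_evalRingHom] at hspec
  refine ⟨a, C ((r * s).eval a)⁻¹ * (C (s.eval a) * U.map (evalRingHom a)),
    C ((r * s).eval a)⁻¹ * (C (r.eval a) * V.map (evalRingHom a)), ?_⟩
  rw [mul_assoc, mul_assoc (C _) (C _ * V.map _), ← mul_add, hspec, ← C_mul, inv_mul_cancel₀ ha, C_1]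

theorem totalDegreeLE_eval₂Hom {K : Type*} [Field K] (v : Fin 2 → K[X][X])
    (hv : ∀ i, TotalDegreeLE 1 (v i)) (p : MvPolynomial (Fin 2) K) :
    TotalDegreeLE p.totalDegree (MvPolynomial.eval₂Hom (C.comp C) v p) := by
  rw [MvPolynomial.coe_eval₂Hom, MvPolynomial.eval₂_eq']
  refine .sum _ fun d hd => ?_
  have hle := MvPolynomial.le_totalDegree hd
  rw [Finsupp.sum_fintype _ _ (fun _ => rfl), Fin.sum_univ_two] at hle
  rw [Fin.prod_univ_two]
  exact ((totalDegreeLE_C_C 0 _).mul (((hv 0).pow _).mul ((hv 1).pow _))).mono (by omega)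

theorem exists_coeff_eval₂Hom_ne_zero {K : Type*} [Field K] [Infinite K]
    (p : MvPolynomial (Fin 2) K) (hp : p ≠ 0) :
    ∃ t : K, (MvPolynomial.eval₂Hom C ![X, C t * X] p).coeff p.totalDegree ≠ 0 := by
  obtain ⟨e, he, hen⟩ := Finset.exists_mem_eq_sup p.support
    (MvPolynomial.support_nonempty.2 hp) (fun s => s.sum fun _ e => e)
  change p.totalDegree = _ at hen
  set n := p.totalDegree
  rw [Finsupp.sum_fintype _ _ (fun _ => rfl), Fin.sum_univ_two] at hen
  set G : K[X] := ∑ d ∈ p.support, if n = d 0 + d 1 then C (p.coeff d) * X ^ d 1 else 0 with hG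
  have hG0 : G ≠ 0 := by
    intro h
    have h1 : G.coeff (e 1) = p.coeff e := by
      rw [hG, finsetSum_coeff, Finset.sum_eq_single_of_mem e he]
      · rw [if_pos hen, coeff_C_mul, coeff_X_pow_self, mul_one]
      · intro d _ hde
        split_ifs with hd
        · rw [coeff_C_mul, coeff_X_pow, if_neg, mul_zero]
          intro h1
          refine hde (Finsupp.ext fun i => ?_)
          fin_cases i
          · exact (by omega : d 0 = e 0)
          · exact h1.symm
        · simp
    rw [h, coeff_zero] at h1
    exact MvPolynomial.mem_support_iff.1 he h1.symm
  obtain ⟨t, ht⟩ : ∃ t, G.eval t ≠ 0 := by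
    by_contra! h
    exact hG0 (Polynomial.funext fun t => by rw [h t, eval_zero])
  refine ⟨t, ?_⟩
  convert ht using 1
  rw [MvPolynomial.coe_eval₂Hom, MvPolynomial.eval₂_eq', finsetSum_coeff, hG, eval_finsetSum]
  refine Finset.sum_congr rfl fun d _ => ?_
  have : C (p.coeff d) * ∏ i, (![X, C t * X] : Fin 2 → K[X]) i ^ d i =
      C (p.coeff d * t ^ d 1) * X ^ (d 0 + d 1) := by
    rw [Fin.prod_univ_two, C_mul, C_pow]
    simp only [Matrix.cons_val_zero, Matrix.cons_val_one]
    ring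
  rw [this, coeff_C_mul, coeff_X_pow]
  split_ifs <;> simp

theorem exists_eq_prod_range_of_separable {K : Type*} [Field K] [IsAlgClosed K] {f : K[X]}
    (hf : f.Monic) (hsep : f.Separable) :
    ∃ c : ℕ → K, Set.InjOn c (Set.Iio f.natDegree) ∧
      f = ∏ i ∈ Finset.range f.natDegree, (X - C (c i)) := by
  classical
  have hsplit := IsAlgClosed.splits f
  have hnd : f.roots.Nodup := nodup_roots hsep
  have hcard : f.roots.toFinset.card = f.natDegree := by
    rw [Multiset.toFinset_card_of_nodup hnd, hsplit.natDegree_eq_card_roots]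
  let e := (f.roots.toFinset.equivFinOfCardEq hcard).symm
  refine ⟨fun i => if h : i < f.natDegree then e ⟨i, h⟩ else 0, ?_, ?_⟩
  · intro i hi j hj hij
    rw [Set.mem_Iio] at hi hj
    simp only [hi, hj, dif_pos] at hij
    simpa using e.injective (Subtype.ext hij)
  · have h1 : f = ∏ a : f.roots.toFinset, (X - C (a : K)) := by
      rw [Finset.prod_coe_sort f.roots.toFinset (fun a => X - C a), Finset.prod,
        Multiset.toFinset_val, hnd.dedup]
      exact hsplit.eq_prod_roots_of_monic hf
    conv_lhs => rw [h1]
    rw [← e.prod_comp, Finset.prod_range]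
    refine Finset.prod_congr rfl fun i _ => ?_
    simp

theorem exists_pencilEntry_eq {K : Type*} [Field K] (c : ℕ → K) (b : ℕ → ℕ → K) (i j : ℕ) :
    ∃ α β γ : K, pencilEntry c b i j = C (C α) + C X * C (C β) + X * C (C γ) := by
  unfold pencilEntry
  split_ifs
  · exact ⟨-c i, 1, b i j, by simp only [C_sub, C_neg, C_1]; ring⟩
  · exact ⟨0, 0, b i j, by simp only [C_0]; ring⟩
  · exact ⟨0, 0, -1, by simp only [C_0, C_neg, C_1]; ring⟩
  · exact ⟨0, 0, 0, by simp only [C_0]; ring⟩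

/-- Substituting `x ↦ x` and `y ↦ t x + y` in `p(x, y)`, as a polynomial in `x` over `K[y]`. -/
noncomputable def shear {K : Type*} [Field K] (t : K) : MvPolynomial (Fin 2) K →+* K[X][X] :=
  MvPolynomial.eval₂Hom (C.comp C) ![X, C (C t) * X + C X]

theorem squarefree_shear {K : Type*} [Field K] (t : K) {p : MvPolynomial (Fin 2) K}
    (hp : Squarefree p) : Squarefree (shear t p) := by
  let χ : K[X][X] →+* MvPolynomial (Fin 2) K :=
    eval₂RingHom (eval₂RingHom MvPolynomial.C
      (MvPolynomial.X 1 - MvPolynomial.C t * MvPolynomial.X 0)) (MvPolynomial.X 0)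
  have h1 : χ.comp (shear t) = RingHom.id _ := by
    refine MvPolynomial.ringHom_ext (fun a => ?_) fun i => ?_
    · simp [χ, shear]
    · fin_cases i <;> simp [χ, shear]
  have h2 : (shear t).comp χ = RingHom.id _ := by
    refine Polynomial.ringHom_ext' (Polynomial.ringHom_ext' (RingHom.ext fun a => ?_) ?_) ?_ <;>
      simp [χ, shear]
  intro g hg
  have hdvd := map_dvd χ hg
  rw [← RingHom.comp_apply, h1, RingHom.id_apply, map_mul] at hdvd
  have hu := (hp _ hdvd).map (shear t)
  rwa [← RingHom.comp_apply, h2] at hu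

/-- Substituting `x ↦ x` and `y ↦ t x + s + y` in `p(x, y)`, as a polynomial in `y` over `K[x]`. -/
noncomputable def shearTranslate {K : Type*} [Field K] (t s : K) :
    MvPolynomial (Fin 2) K →+* K[X][X] :=
  MvPolynomial.eval₂Hom (C.comp C) ![C X, C (C t) * C X + C (C s) + X]

theorem coeff_zero_shearTranslate {K : Type*} [Field K] (t s : K) (p : MvPolynomial (Fin 2) K) :
    (shearTranslate t s p).coeff 0 = (shear t p).map (evalRingHom s) := by
  have h : constantCoeff.comp (shearTranslate t s) =
      (mapRingHom (evalRingHom s)).comp (shear t) := by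
    refine MvPolynomial.ringHom_ext (fun a => ?_) fun i => ?_
    · simp [shear, shearTranslate]
    · fin_cases i <;> simp [shear, shearTranslate]
  exact RingHom.congr_fun h p

theorem totalDegreeLE_shear {K : Type*} [Field K] (t : K) (p : MvPolynomial (Fin 2) K) :
    TotalDegreeLE p.totalDegree (shear t p) := by
  refine totalDegreeLE_eval₂Hom _ (fun i => ?_) p
  fin_cases i
  · exact totalDegreeLE_X
  · exact (((totalDegreeLE_C_C 0 t).mul totalDegreeLE_X).mono (by omega)).add totalDegreeLE_C_X

theorem totalDegreeLE_shearTranslate {K : Type*} [Field K] (t s : K)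
    (p : MvPolynomial (Fin 2) K) : TotalDegreeLE p.totalDegree (shearTranslate t s p) := by
  refine totalDegreeLE_eval₂Hom _ (fun i => ?_) p
  fin_cases i
  · exact totalDegreeLE_C_X
  · exact ((((totalDegreeLE_C_C 0 t).mul totalDegreeLE_C_X).mono (by omega)).add
      (totalDegreeLE_C_C 1 s)).add totalDegreeLE_X

theorem exists_coeff_shear_eq_C {K : Type*} [Field K] [Infinite K]
    (p : MvPolynomial (Fin 2) K) (hp : p ≠ 0) :
    ∃ t a : K, a ≠ 0 ∧ (shear t p).coeff p.totalDegree = C a := by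
  obtain ⟨t, ht⟩ := exists_coeff_eval₂Hom_ne_zero p hp
  refine ⟨t, ((shear t p).coeff p.totalDegree).coeff 0, ?_, ?_⟩
  · have h : (mapRingHom (evalRingHom 0)).comp (shear t) =
        MvPolynomial.eval₂Hom C ![X, C t * X] := by
      refine MvPolynomial.ringHom_ext (fun a => ?_) fun i => ?_
      · simp [shear]
      · fin_cases i <;> simp [shear]
    rw [← h, RingHom.comp_apply, coe_mapRingHom, coeff_map, coe_evalRingHom] at ht
    rwa [coeff_zero_eq_eval_zero]
  · refine eq_C_of_natDegree_eq_zero (Nat.le_zero.1 (natDegree_le_iff_coeff_eq_zero.2 ?_))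
    intro i hi
    exact totalDegreeLE_shear t p i _ (by omega)

theorem exists_det_eq {K : Type*} [Field K] [IsAlgClosed K] [CharZero K]
    (p : MvPolynomial (Fin 2) K) (hp : 1 ≤ p.totalDegree) (hsf : Squarefree p) :
    ∃ A B D : Matrix (Fin p.totalDegree) (Fin p.totalDegree) K,
      (Matrix.of fun i j => MvPolynomial.C (A i j) + MvPolynomial.X 0 * MvPolynomial.C (B i j)
        + MvPolynomial.X 1 * MvPolynomial.C (D i j)).det = p := by
  set n := p.totalDegree with hn
  have hp0 : p ≠ 0 := by
    rintro rfl
    simp [hn] at hp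
  obtain ⟨t, a, ha, hcoeff⟩ := exists_coeff_shear_eq_C p hp0
  have hCa : (C (C a⁻¹) * C (C a) : K[X][X]) = 1 := by
    rw [← C_mul, ← C_mul, inv_mul_cancel₀ ha, C_1, C_1]
  set q : K[X][X] := C (C a⁻¹) * shear t p with hq
  have hqdeg : q.natDegree ≤ n := by
    refine natDegree_le_iff_coeff_eq_zero.2 fun j hj => ?_
    ext i
    exact ((totalDegreeLE_C_C 0 a⁻¹).mul (totalDegreeLE_shear t p)) i j (by omega)
  have hqcoeff : q.coeff n = 1 := by
    rw [hq, coeff_C_mul, hcoeff, ← C_mul, inv_mul_cancel₀ ha, C_1]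
  have hqmonic : q.Monic := monic_of_natDegree_le_of_coeff_eq_one n hqdeg hqcoeff
  have hqn : q.natDegree = n :=
    le_antisymm hqdeg (le_natDegree_of_ne_zero (by rw [hqcoeff]; exact one_ne_zero))
  have hqsf : Squarefree q := (squarefree_shear t hsf).squarefree_of_dvd
    ⟨C (C a), by rw [hq, mul_right_comm, hCa, one_mul]⟩
  obtain ⟨s, hs⟩ := exists_separable_specialization hqmonic hqsf
  obtain ⟨c, hc, hprod⟩ := exists_eq_prod_range_of_separable (hqmonic.map _) hs
  rw [hqmonic.natDegree_map, hqn] at hc hprod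
  obtain ⟨b, hb⟩ := exists_pencilDet_eq c n hc (C (C a⁻¹) * shearTranslate t s p)
    (((totalDegreeLE_C_C 0 a⁻¹).mul (totalDegreeLE_shearTranslate t s p)).mono (by omega)) (by
      rw [← hprod, hq, coeff_C_mul, coeff_zero_shearTranslate, Polynomial.map_mul, map_C,
        coe_evalRingHom, eval_C])
  obtain ⟨e, he⟩ := IsAlgClosed.exists_pow_nat_eq a hp
  let χ : K[X][X] →+* MvPolynomial (Fin 2) K :=
    eval₂RingHom (eval₂RingHom MvPolynomial.C (MvPolynomial.X 0))
      (MvPolynomial.X 1 - MvPolynomial.C t * MvPolynomial.X 0 - MvPolynomial.C s)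
  have hχ : χ.comp (shearTranslate t s) = RingHom.id _ := by
    refine MvPolynomial.ringHom_ext (fun a => ?_) fun i => ?_
    · simp [χ, shearTranslate]
    · fin_cases i <;> simp [χ, shearTranslate]
  have hdet : p = (χ.mapMatrix (C (C e) •
      Matrix.of fun i j : Fin n => pencilEntry c b i j)).det := by
    rw [← RingHom.map_det, Matrix.det_smul, Fintype.card_fin, ← C_pow, ← C_pow, he]
    change p = χ (C (C a) * pencilDet c b n)
    rw [hb, ← mul_assoc, mul_comm (C (C a)), hCa, one_mul]
    exact (RingHom.congr_fun hχ p).symm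
  choose α β γ h using exists_pencilEntry_eq c b
  refine ⟨fun i j => e * (α i j - s * γ i j), fun i j => e * (β i j - t * γ i j),
    fun i j => e * γ i j, ?_⟩
  conv_rhs => rw [hdet]
  congr 1
  ext1 i j
  simp only [Matrix.of_apply, RingHom.mapMatrix_apply, Matrix.map_apply, Matrix.smul_apply, h,
    smul_eq_mul, χ, map_mul, map_sub, coe_eval₂RingHom, eval₂_add, eval₂_mul, eval₂_C, eval₂_X]
  ring

/-- Every square-free bivariate polynomial `p` over `ℂ` of total
degree `n ≥ 1` admits a determinantal representation of order `n`:
there are matrices `A, B, C ∈ ℂ^{n×n}` with `det(A + x B + y C) = p(x, y)`. -/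
theorem squarefree_bivariate_det_representation
    (n : ℕ) (hn : 1 ≤ n) (p : MvPolynomial (Fin 2) ℂ)
    (hsf : Squarefree p) (hdeg : p.totalDegree = n) :
    ∃ A B C : Matrix (Fin n) (Fin n) ℂ,
      (Matrix.of fun i j =>
          MvPolynomial.C (A i j)
          + MvPolynomial.X 0 * MvPolynomial.C (B i j)
          + MvPolynomial.X 1 * MvPolynomial.C (C i j)).det = p := by
  subst hdeg
  exact exists_det_eq p hn hsf
end

section
/- Let n ≥ 3, let ξ_1, …, ξ_{n-1} be pairwise distinct complex numbers, and fix k with 1 ≤ k ≤ n−2. Define the univariate polynomials w_ℓ(t) := ∏_{i=1}^{ℓ-1}(t − ξ_i) · ∏_{j=ℓ+k}^{n-1}(t − ξ_j) for ℓ = 1, …, n−k. Then w_1, …, w_{n-k} form a basis of the vector space of complex univariate polynomials of degree less than or equal to n−k−1. -/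
open Polynomial in
/-- Polynomials whose matrix of values at a finite sequence of points is triangular with nonzero
diagonal are linearly independent. -/
theorem linearIndependent_of_eval_triangular {K : Type*} [Field K] {N : ℕ}
    (p : Fin N → K[X]) (x : Fin N → K)
    (hzero : ∀ i j, j < i → (p i).eval (x j) = 0) (hdiag : ∀ i, (p i).eval (x i) ≠ 0) :
    LinearIndependent K p := by
  refine LinearIndependent.of_comp (LinearMap.pi fun j => Polynomial.leval (x j)) ?_
  have hdet : (Matrix.of fun i j => (p i).eval (x j)).det ≠ 0 := by
    have htri : (Matrix.of fun i j => (p i).eval (x j)).IsUpperTriangular :=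
      fun i j hij => hzero i j hij
    rw [Matrix.det_of_isUpperTriangular htri]
    exact Finset.prod_ne_zero_iff.mpr fun i _ => hdiag i
  exact Matrix.linearIndependent_rows_of_det_ne_zero hdet

open Polynomial in
/-- A linearly independent family of `N` polynomials of degree less than `N` spans the space of
all polynomials of degree less than `N`. -/
theorem span_range_eq_degreeLT {K : Type*} [Field K] {N : ℕ} {p : Fin N → K[X]}
    (hp : LinearIndependent K p) (hdeg : ∀ i, (p i).degree < N) :
    Submodule.span K (Set.range p) = degreeLT K N := by
  have : FiniteDimensional K (degreeLT K N) := (degreeLTEquiv K N).symm.finiteDimensional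
  apply Submodule.eq_of_le_of_finrank_eq
  · rw [Submodule.span_le]
    rintro _ ⟨i, rfl⟩
    exact mem_degreeLT.mpr (hdeg i)
  · rw [finrank_span_eq_card hp, (degreeLTEquiv K N).finrank_eq]
    simp


/-- For `n ≥ 3`, pairwise distinct `ξ_1, …, ξ_{n-1} ∈ ℂ` and
`1 ≤ k ≤ n-2`, the polynomials
`w_ℓ(t) = ∏_{i=1}^{ℓ-1}(t - ξ_i) ∏_{j=ℓ+k}^{n-1}(t - ξ_j)`, `ℓ = 1, …, n-k`,
form a basis of the space of complex polynomials of degree ≤ n-k-1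
(i.e. of degree < n-k): they are linearly independent and span that space. -/
theorem w_polynomials_form_basis
    (n k : ℕ) (hn : 3 ≤ n) (hk1 : 1 ≤ k) (hk2 : k ≤ n - 2)
    (ξ : ℕ → ℂ)
    (hdist : ∀ i ∈ Finset.Icc 1 (n - 1), ∀ j ∈ Finset.Icc 1 (n - 1), i ≠ j → ξ i ≠ ξ j)
    (w : ℕ → Polynomial ℂ)
    (hw : ∀ ℓ, w ℓ =
      (∏ i ∈ Finset.Icc 1 (ℓ - 1), (Polynomial.X - Polynomial.C (ξ i))) *
      (∏ j ∈ Finset.Icc (ℓ + k) (n - 1), (Polynomial.X - Polynomial.C (ξ j)))) :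
    LinearIndependent ℂ (fun ℓ : Fin (n - k) => w (ℓ.1 + 1)) ∧
    Submodule.span ℂ (Set.range fun ℓ : Fin (n - k) => w (ℓ.1 + 1)) =
      Polynomial.degreeLT ℂ (n - k) := by
  have hind : LinearIndependent ℂ (fun ℓ : Fin (n - k) => w (ℓ.1 + 1)) := by
    refine linearIndependent_of_eval_triangular _ (fun j => ξ (j.1 + 1)) ?_ ?_
    · intro i j hij
      have hmem : j.1 + 1 ∈ Finset.Icc 1 (i.1 + 1 - 1) := by
        rw [Finset.mem_Icc]
        omega
      rw [hw, Polynomial.eval_mul, Polynomial.eval_prod, Finset.prod_eq_zero hmem (by simp),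
        zero_mul]
    · intro i
      have hi := i.2
      rw [hw, Polynomial.eval_mul, Polynomial.eval_prod, Polynomial.eval_prod]
      refine mul_ne_zero ?_ ?_ <;>
      · refine Finset.prod_ne_zero_iff.mpr fun j hj => ?_
        rw [Finset.mem_Icc] at hj
        rw [Polynomial.eval_sub, Polynomial.eval_X, Polynomial.eval_C, sub_ne_zero]
        exact hdist _ (Finset.mem_Icc.mpr (by omega)) _ (Finset.mem_Icc.mpr (by omega)) (by omega)
  refine ⟨hind, span_range_eq_degreeLT hind fun i => ?_⟩
  have hi := i.2
  rw [hw, Polynomial.degree_mul, Polynomial.degree_prod, Polynomial.degree_prod]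
  simp only [Polynomial.degree_X_sub_C, Finset.sum_const, Nat.card_Icc, nsmul_one]
  norm_cast
  omega
end

section
/- Let n ≥ 3, let ξ_1, …, ξ_{n-1} be pairwise distinct complex numbers, and fix k with 2 ≤ k ≤ n−2. Then for every complex univariate polynomial H of degree at most n−k, there exist α ∈ ℂ and β_k, β_{k+1}, …, β_{n-1} ∈ ℂ such that H(t) = Σ_{ℓ=k}^{n-2} (t + β_ℓ) · ∏_{i=1}^{ℓ-k}(t − ξ_i) · ∏_{j=ℓ+1}^{n-1}(t − ξ_j) + (αt + β_{n-1}) · ∏_{i=1}^{n-k-1}(t − ξ_i) holds identically in t. Moreover, α is uniquely determined as α = c − (n−k−1), where c is the coefficient of t^{n-k} in H. -/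
open Polynomial Finset

/-- The product of the factors `X - ξ i` over the indices `1 ≤ i < n` outside the window
`ℓ - k < i ≤ ℓ`. -/
noncomputable def gapProd {K : Type*} [Field K] (ξ : ℕ → K) (k n ℓ : ℕ) : K[X] :=
  (∏ i ∈ Icc 1 (ℓ - k), (X - C (ξ i))) * ∏ j ∈ Ico (ℓ + 1) n, (X - C (ξ j))

theorem gapProd_monic {K : Type*} [Field K] (ξ : ℕ → K) (k n ℓ : ℕ) :
    (gapProd ξ k n ℓ).Monic :=
  (monic_prod_of_monic _ _ fun i _ => monic_X_sub_C (ξ i)).mul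
    (monic_prod_of_monic _ _ fun i _ => monic_X_sub_C (ξ i))

theorem natDegree_gapProd {K : Type*} [Field K] (ξ : ℕ → K) {k n ℓ : ℕ}
    (hk : k ≤ ℓ) (hn : ℓ < n) : (gapProd ξ k n ℓ).natDegree = n - k - 1 := by
  rw [gapProd, (monic_prod_of_monic _ _ fun i _ => monic_X_sub_C (ξ i)).natDegree_mul
    (monic_prod_of_monic _ _ fun i _ => monic_X_sub_C (ξ i)),
    natDegree_finsetProd_X_sub_C_eq_card, natDegree_finsetProd_X_sub_C_eq_card]
  simp only [Nat.card_Icc, Nat.card_Ico]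
  omega

theorem gapProd_succ {K : Type*} [Field K] (ξ : ℕ → K) {k n ℓ : ℕ} (hn : ℓ < n) :
    gapProd ξ k (n + 1) ℓ = (X - C (ξ n)) * gapProd ξ k n ℓ := by
  rw [gapProd, prod_Ico_succ_top hn, gapProd]
  ring

/-- The polynomials `gapProd ξ k (k + m) ℓ`, `k ≤ ℓ < k + m`, span the polynomials of degree
less than `m`. -/
theorem exists_eq_sum_gapProd {K : Type*} [Field K] (ξ : ℕ → K) {k : ℕ} (hk : 0 < k) (m : ℕ)
    (hξ : ∀ i j, 1 ≤ i → i < j → j < k + m → ξ i ≠ ξ j) (P : K[X]) (hP : P.degree < m) :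
    ∃ b : ℕ → K, P = ∑ ℓ ∈ Ico k (k + m), C (b ℓ) * gapProd ξ k (k + m) ℓ := by
  induction m generalizing P with
  | zero => exact ⟨0, by simpa using hP⟩
  | succ m ih =>
    set W := gapProd ξ k (k + m + 1) (k + m) with hW
    have hWne : W.eval (ξ (k + m)) ≠ 0 := by
      simp only [hW, gapProd, Ico_self, prod_empty, mul_one, eval_prod, eval_sub, eval_X, eval_C]
      refine prod_ne_zero_iff.2 fun i hi => sub_ne_zero.2 (hξ i (k + m) ?_ ?_ ?_).symm <;>
        simp only [mem_Icc] at hi <;> omega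
    set c := P.eval (ξ (k + m)) / W.eval (ξ (k + m)) with hc
    have hroot : (P - C c * W).IsRoot (ξ (k + m)) := by
      simp [hc, div_mul_cancel₀ _ hWne]
    obtain ⟨Q, hQ⟩ := dvd_iff_isRoot.2 hroot
    have hWdeg : W.degree < (m + 1 : ℕ) := by
      rw [degree_eq_natDegree (gapProd_monic ..).ne_zero,
        natDegree_gapProd ξ (Nat.le_add_right k m) (Nat.lt_succ_self _), Nat.cast_lt]
      omega
    have hQdeg : Q.degree < m := by
      have h : (P - C c * W).degree < (m + 1 : ℕ) :=
        (degree_sub_le _ _).trans_lt (max_lt hP ((smul_eq_C_mul c (p := W) ▸ degree_smul_le c W).trans_lt hWdeg))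
      by_cases hQ0 : Q = 0
      · simp [hQ0]
      · rw [hQ, degree_mul, degree_X_sub_C, degree_eq_natDegree hQ0] at h
        rw [degree_eq_natDegree hQ0]
        norm_cast at h ⊢
        omega
    obtain ⟨b, hb⟩ := ih (fun i j hi hij hj => hξ i j hi hij (by omega)) Q hQdeg
    refine ⟨Function.update b (k + m) c, ?_⟩
    rw [← add_assoc, sum_Ico_succ_top (Nat.le_add_right k m), Function.update_self, ← hW,
      ← sub_eq_iff_eq_add, hQ, hb, mul_sum]
    refine sum_congr rfl fun ℓ hℓ => ?_
    have hlt := (mem_Ico.1 hℓ).2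
    rw [Function.update_of_ne hlt.ne, gapProd_succ ξ hlt]
    ring

/-- For `n ≥ 3`, pairwise distinct `ξ_1, …, ξ_{n-1} ∈ ℂ` and
`2 ≤ k ≤ n-2`: every polynomial `H` of degree at most `n-k` can be written as
`H(t) = ∑_{ℓ=k}^{n-2} (t + β_ℓ) ∏_{i=1}^{ℓ-k}(t - ξ_i) ∏_{j=ℓ+1}^{n-1}(t - ξ_j)
      + (αt + β_{n-1}) ∏_{i=1}^{n-k-1}(t - ξ_i)`,
with `α = c - (n-k-1)` where `c` is the coefficient of `t^{n-k}` in `H`. -/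
theorem coefficient_decomposition_exists
    (n k : ℕ) (hn : 3 ≤ n) (hk1 : 2 ≤ k) (hk2 : k ≤ n - 2)
    (ξ : ℕ → ℂ)
    (hdist : ∀ i ∈ Finset.Icc 1 (n - 1), ∀ j ∈ Finset.Icc 1 (n - 1), i ≠ j → ξ i ≠ ξ j)
    (H : Polynomial ℂ) (hH : H.natDegree ≤ n - k) :
    ∃ (α : ℂ) (β : ℕ → ℂ),
      H = (∑ ℓ ∈ Finset.Icc k (n - 2), (Polynomial.X + Polynomial.C (β ℓ)) *
            ((∏ i ∈ Finset.Icc 1 (ℓ - k), (Polynomial.X - Polynomial.C (ξ i))) *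
             (∏ j ∈ Finset.Icc (ℓ + 1) (n - 1), (Polynomial.X - Polynomial.C (ξ j)))))
          + (Polynomial.C α * Polynomial.X + Polynomial.C (β (n - 1))) *
            ∏ i ∈ Finset.Icc 1 (n - k - 1), (Polynomial.X - Polynomial.C (ξ i)) ∧
      α = H.coeff (n - k) - ((n - k - 1 : ℕ) : ℂ) := by
  obtain ⟨m, rfl⟩ : ∃ m, n = k + (m + 1) := ⟨n - k - 1, by omega⟩
  simp only [show k + (m + 1) - k = m + 1 by omega, show k + (m + 1) - 1 = k + m by omega,
    Nat.add_sub_cancel] at *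
  set W := gapProd ξ k (k + (m + 1)) with hW
  have hdeg : ∀ ℓ ∈ Ico k (k + (m + 1)), (W ℓ).natDegree = m := fun ℓ hℓ => by
    rw [mem_Ico] at hℓ
    rw [hW, natDegree_gapProd ξ hℓ.1 hℓ.2]
    omega
  have hcoeff : ∀ ℓ ∈ Ico k (k + (m + 1)), (W ℓ).coeff m = 1 := fun ℓ hℓ => by
    rw [← hdeg ℓ hℓ]
    exact (gapProd_monic ..).coeff_natDegree
  have htop : k + m ∈ Ico k (k + (m + 1)) := by simp
  have hmem : ∀ ℓ ∈ Ico k (k + m), ℓ ∈ Ico k (k + (m + 1)) := fun ℓ hℓ => by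
    rw [mem_Ico] at hℓ ⊢
    omega
  set α : ℂ := H.coeff (m + 1) - (m : ℂ) with hα
  set S : ℂ[X] := X * (∑ ℓ ∈ Ico k (k + m), W ℓ + C α * W (k + m)) with hS
  have hSdeg : S.natDegree ≤ m + 1 := by
    rw [hS, add_comm m 1]
    refine natDegree_mul_le_of_le natDegree_X_le (natDegree_add_le_of_degree_le
      (natDegree_sum_le_of_forall_le _ _ fun ℓ hℓ => (hdeg ℓ (hmem ℓ hℓ)).le)
      ((natDegree_C_mul_le _ _).trans (hdeg _ htop).le))
  have hScoeff : S.coeff (m + 1) = H.coeff (m + 1) := by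
    rw [hS, coeff_X_mul, coeff_add, finsetSum_coeff, coeff_C_mul, hcoeff _ htop,
      sum_congr rfl fun ℓ hℓ => hcoeff ℓ (hmem ℓ hℓ)]
    simp [hα]
  have hPdeg : (H - S).degree < (m + 1 : ℕ) := by
    rw [degree_lt_iff_coeff_zero]
    intro i hi
    rw [coeff_sub]
    rcases hi.eq_or_lt with rfl | hi
    · rw [hScoeff, sub_self]
    · rw [coeff_eq_zero_of_natDegree_lt (hH.trans_lt hi),
        coeff_eq_zero_of_natDegree_lt (hSdeg.trans_lt hi), sub_self]
  obtain ⟨β, hβ⟩ := exists_eq_sum_gapProd ξ (by omega : 0 < k) (m + 1)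
    (fun i j hi hij hj => hdist i (mem_Icc.2 (by omega)) j (mem_Icc.2 (by omega)) hij.ne)
    (H - S) hPdeg
  refine ⟨α, β, ?_, rfl⟩
  have hWtop : W (k + m) = ∏ i ∈ Icc 1 m, (X - C (ξ i)) := by
    simp [hW, gapProd, ← add_assoc]
  have hIcc : Icc k (k + (m + 1) - 2) = Ico k (k + m) := by
    ext
    simp only [mem_Icc, mem_Ico]
    omega
  have hWℓ : ∀ ℓ, (∏ i ∈ Icc 1 (ℓ - k), (X - C (ξ i))) *
      ∏ j ∈ Icc (ℓ + 1) (k + m), (X - C (ξ j)) = W ℓ := fun ℓ => by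
    rw [hW, gapProd, ← add_assoc, Ico_add_one_right_eq_Icc]
  rw [← hWtop, hIcc]
  simp only [hWℓ]
  rw [← hW, ← add_assoc, sum_Ico_succ_top (Nat.le_add_right k m), sub_eq_iff_eq_add] at hβ
  rw [hβ, hS]
  simp only [add_mul, sum_add_distrib, mul_add, mul_sum]
  ring
end

section
/- Let n ≥ 2, and for 1 ≤ j ≤ i ≤ n−1 let f_{ij}(x,y) = α_{ij}x + β_{ij}y be linear forms over ℂ. Define bivariate polynomials q_0, …, q_{n-1} recursively by q_0 := 1 and q_i := Σ_{ℓ=1}^{i} f_{iℓ}·q_{i-ℓ} for i = 1, …, n−1. Let γ_{00}, γ_{10}, γ_1, …, γ_{n-2}, c ∈ ℂ, and let M(x,y) be the n×n matrix with: first-row entries M_{1,1} = γ_{00} + γ_{10}x, M_{1,j+1} = γ_j for j = 1,…,n−2, M_{1,n} = c·x; diagonal entries M_{i+1,i+1} = 1 for i = 1,…,n−1; subdiagonal entries M_{i+1,j} = −f_{i,i+1-j}(x,y) for 1 ≤ j ≤ i ≤ n−1; and all other entries zero. Then det M(x,y) = γ_{00} + γ_{10}x + Σ_{j=1}^{n-2}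 γ_j·q_j(x,y) + c·x·q_{n-1}(x,y). -/
open scoped Matrix in
/-- If `M` sends a vector with first entry `1` to a multiple `d` of the first basis vector, and the
lower right block of `M` is lower unitriangular, then `det M = d`. -/
theorem Matrix.det_eq_of_mulVec_eq_single {R : Type*} [CommRing R] {m : ℕ}
    (M : Matrix (Fin (m + 1)) (Fin (m + 1)) R) (v : Fin (m + 1) → R) (d : R) (hv : v 0 = 1)
    (hMv : M *ᵥ v = Pi.single 0 d) (hdiag : ∀ i : Fin m, M i.succ i.succ = 1)
    (hupper : ∀ i j : Fin m, i < j → M i.succ j.succ = 0) : M.det = d := by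
  have hadj : M.adjugate 0 0 = 1 := by
    rw [Matrix.adjugate_fin_succ_eq_det_submatrix, Matrix.det_of_isLowerTriangular]
    · simp [hdiag]
    · intro i j hij
      simpa using hupper i j (by simpa using hij)
  have h : (M.adjugate *ᵥ (M *ᵥ v)) 0 = M.det := by
    rw [Matrix.mulVec_mulVec, Matrix.adjugate_mul, Matrix.smul_mulVec, Matrix.one_mulVec]
    simp [hv]
  rw [← h, hMv, Matrix.mulVec_single]
  simp [hadj]

/-- Determinant of the ansatz matrix. With linear forms
`f_{ij} = α_{ij}x + β_{ij}y` (`1 ≤ j ≤ i ≤ n-1`) and the recursively defined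
polynomials `q_0 = 1`, `q_i = ∑_{ℓ=1}^{i} f_{iℓ} q_{i-ℓ}`, the `n×n` matrix `M`
with first row `(γ_{00} + γ_{10}x, γ_1, …, γ_{n-2}, c·x)`, unit diagonal below the
first row, entries `M_{i+1,j} = -f_{i,i+1-j}` for `1 ≤ j ≤ i ≤ n-1`, and zeros
elsewhere satisfies
`det M = γ_{00} + γ_{10}x + ∑_{j=1}^{n-2} γ_j q_j + c·x·q_{n-1}`.
(Indices of `M` are `0`-based; `x = X 0`, `y = X 1`.) -/
theorem ansatz_matrix_determinant
    (n : ℕ) (hn : 2 ≤ n)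
    (f : ℕ → ℕ → MvPolynomial (Fin 2) ℂ) (α β : ℕ → ℕ → ℂ)
    (hf : ∀ i j : ℕ, 1 ≤ j → j ≤ i → i ≤ n - 1 →
      f i j = MvPolynomial.C (α i j) * MvPolynomial.X 0
            + MvPolynomial.C (β i j) * MvPolynomial.X 1)
    (q : ℕ → MvPolynomial (Fin 2) ℂ)
    (hq0 : q 0 = 1)
    (hq : ∀ i : ℕ, 1 ≤ i → i ≤ n - 1 → q i = ∑ ℓ ∈ Finset.Icc 1 i, f i ℓ * q (i - ℓ))
    (γ₀₀ γ₁₀ c : ℂ) (γ : ℕ → ℂ)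
    (M : Matrix (Fin n) (Fin n) (MvPolynomial (Fin 2) ℂ))
    (hM : ∀ i j : Fin n, M i j =
      if (i : ℕ) = 0 then
        (if (j : ℕ) = 0 then MvPolynomial.C γ₀₀ + MvPolynomial.C γ₁₀ * MvPolynomial.X 0
         else if (j : ℕ) = n - 1 then MvPolynomial.C c * MvPolynomial.X 0
         else MvPolynomial.C (γ (j : ℕ)))
      else if (j : ℕ) = (i : ℕ) then 1
      else if (j : ℕ) < (i : ℕ) then -f (i : ℕ) ((i : ℕ) - (j : ℕ))
      else 0) :
    M.det = MvPolynomial.C γ₀₀ + MvPolynomial.C γ₁₀ * MvPolynomial.X 0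
      + (∑ j ∈ Finset.Icc 1 (n - 2), MvPolynomial.C (γ j) * q j)
      + MvPolynomial.C c * MvPolynomial.X 0 * q (n - 1) := by
  obtain ⟨k, rfl⟩ : ∃ k, n = k + 1 + 1 := ⟨n - 2, by omega⟩
  refine Matrix.det_eq_of_mulVec_eq_single M (fun j => q j) _ (by simpa using hq0) ?_ ?_ ?_
  · ext1 i
    refine Fin.cases ?_ (fun i => ?_) i
    · have hsum : ∑ j ∈ Finset.Icc 1 k, MvPolynomial.C (γ j) * q j
          = ∑ j : Fin k, MvPolynomial.C (γ (j + 1)) * q (j + 1) := by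
        rw [← Finset.Ico_add_one_right_eq_Icc, Finset.sum_Ico_eq_sum_range, Finset.sum_range]
        simp [add_comm 1]
      have hne (j : Fin k) : (j : ℕ) ≠ k := j.isLt.ne
      rw [Matrix.mulVec, dotProduct, Fin.sum_univ_succ, Fin.sum_univ_castSucc]
      simp [hM, hq0, hsum, hne, add_assoc]
    · have hi : (i : ℕ) < k + 1 := i.isLt
      rw [Matrix.mulVec, dotProduct, Pi.single_eq_of_ne (Fin.succ_ne_zero i)]
      have hrow : ∑ j : Fin (k + 1 + 1), M i.succ j * q j
          = ∑ j ∈ Finset.range (k + 1 + 1), if j = (i : ℕ) + 1 then q j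
              else if j < (i : ℕ) + 1 then -(f (i + 1) (i + 1 - j) * q j) else 0 := by
        rw [Finset.sum_range]
        refine Finset.sum_congr rfl fun j _ => ?_
        rw [hM]
        simp only [Fin.val_succ, Nat.add_one_ne_zero, if_false]
        split_ifs <;> simp
      have hsub : Finset.range (i + 1 + 1) ⊆ Finset.range (k + 1 + 1) :=
        Finset.range_subset_range.2 (by omega)
      rw [hrow, ← Finset.sum_subset hsub, Finset.sum_range_succ, if_pos rfl,
        hq (i + 1) (by omega) (by omega), ← Finset.Ico_add_one_right_eq_Icc,
        Finset.sum_Ico_eq_sum_range, ← Finset.sum_range_reflect, add_tsub_cancel_right,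
        add_tsub_cancel_right, ← Finset.sum_add_distrib]
      · refine Finset.sum_eq_zero fun j hj => ?_
        have hj' : j < (i : ℕ) + 1 := Finset.mem_range.1 hj
        rw [if_neg (by omega), if_pos (by omega), show (i : ℕ) + 1 - (i - j) = 1 + j by omega,
          show (i : ℕ) + 1 - (1 + j) = i - j by omega, neg_add_cancel]
      · intro j _ hj
        rw [Finset.mem_range] at hj
        rw [if_neg (by omega), if_neg (by omega)]
  · intro i
    simp [hM]
  · intro i j hij
    have hij' : (i : ℕ) < j := hij
    simp [hM, hij'.ne', hij.not_gt]
end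

section
/- Let n ≥ 2, and for 1 ≤ j ≤ i ≤ n−1 let f_{ij}(x,y) = α_{ij}x + β_{ij}y be linear forms over ℂ with f_{i1}(x,y) = x − ξ_i y for given ξ_1, …, ξ_{n-1} ∈ ℂ. Define q_0 := 1 and q_i := Σ_{ℓ=1}^{i} f_{iℓ}·q_{i-ℓ} for i = 1, …, n−1. Then each q_j is a bivariate polynomial of total degree exactly j, and its homogeneous part of degree j equals ∏_{i=1}^{j}(x − ξ_i y). In particular, the coefficient of y^j in q_j equals (−1)^j ξ_1ξ_2⋯ξ_j. -/
namespace MvPolynomial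

variable {σ R : Type*} [CommRing R]

theorem IsHomogeneous.homogeneousComponent_add_mul {φ : MvPolynomial σ R} {m : ℕ}
    (hφ : φ.IsHomogeneous m) (n : ℕ) (p : MvPolynomial σ R) :
    homogeneousComponent (m + n) (φ * p) = φ * homogeneousComponent n p := by
  let := gradedAlgebra (σ := σ) (R := R)
  simpa [← decomposition.decompose'_apply] using
    DirectSum.coe_decompose_mul_add_of_left_mem (homogeneousSubmodule σ R) (b := p) (j := n)
      ((mem_homogeneousSubmodule m φ).2 hφ)

theorem coeff_single_prod_X_sub_C_mul_X (ξ : ℕ → R) (j : ℕ) :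
    coeff (Finsupp.single 1 j)
        (∏ i ∈ Finset.Icc 1 j, (X 0 - C (ξ i) * X 1 : MvPolynomial (Fin 2) R)) =
      (-1) ^ j * ∏ i ∈ Finset.Icc 1 j, ξ i := by
  induction j with
  | zero => simp
  | succ j ih =>
    rw [Finset.prod_Icc_succ_top (by omega), Finset.prod_Icc_succ_top (by omega), mul_comm,
      sub_mul, coeff_sub, coeff_X_mul', mul_assoc, coeff_C_mul, add_comm j 1,
      Finsupp.single_add, coeff_X_mul, ih]
    simp [← Finsupp.single_add]
    ring

theorem X_sub_C_mul_X_ne_zero [Nontrivial R] {i k : σ} (hik : i ≠ k) (c : R) :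
    (X i - C c * X k : MvPolynomial σ R) ≠ 0 := by
  classical
  intro h
  have := congrArg (coeff (Finsupp.single i 1)) h
  simp [coeff_C_mul, coeff_X, Finsupp.single_left_inj, hik.symm] at this

theorem totalDegree_le_of_linear_recursion {N : ℕ} {f : ℕ → ℕ → MvPolynomial σ R}
    {q : ℕ → MvPolynomial σ R}
    (hf : ∀ i j : ℕ, 1 ≤ j → j ≤ i → i ≤ N → (f i j).IsHomogeneous 1) (hq0 : q 0 = 1)
    (hq : ∀ i : ℕ, 1 ≤ i → i ≤ N → q i = ∑ ℓ ∈ Finset.Icc 1 i, f i ℓ * q (i - ℓ))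
    (j : ℕ) (hj : j ≤ N) : (q j).totalDegree ≤ j := by
  induction j using Nat.strong_induction_on with
  | _ j ih =>
    rcases Nat.eq_zero_or_pos j with rfl | hpos
    · simp [hq0]
    · rw [hq j hpos hj]
      refine totalDegree_finsetSum_le fun ℓ hℓ => (totalDegree_mul _ _).trans ?_
      obtain ⟨h1, h2⟩ := Finset.mem_Icc.1 hℓ
      have := (hf j ℓ h1 h2 hj).totalDegree_le
      have := ih (j - ℓ) (by omega) (by omega)
      omega

theorem homogeneousComponent_of_linear_recursion {N : ℕ} {f : ℕ → ℕ → MvPolynomial σ R}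
    {q : ℕ → MvPolynomial σ R}
    (hf : ∀ i j : ℕ, 1 ≤ j → j ≤ i → i ≤ N → (f i j).IsHomogeneous 1) (hq0 : q 0 = 1)
    (hq : ∀ i : ℕ, 1 ≤ i → i ≤ N → q i = ∑ ℓ ∈ Finset.Icc 1 i, f i ℓ * q (i - ℓ))
    (j : ℕ) (hj : j ≤ N) :
    homogeneousComponent j (q j) = ∏ i ∈ Finset.Icc 1 j, f i 1 := by
  induction j with
  | zero => simp [hq0]
  | succ j ih =>
    rw [hq (j + 1) (by omega) hj, map_sum, Finset.sum_eq_single 1, Nat.add_sub_cancel,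
      Finset.prod_Icc_succ_top (by omega), ← ih (by omega), add_comm j 1,
      (hf (1 + j) 1 le_rfl (by omega) (by omega)).homogeneousComponent_add_mul, mul_comm]
    · intro ℓ hℓ hne
      obtain ⟨h1, h2⟩ := Finset.mem_Icc.1 hℓ
      refine homogeneousComponent_eq_zero _ _ ((totalDegree_mul _ _).trans_lt ?_)
      have := (hf (j + 1) ℓ h1 h2 hj).totalDegree_le
      have := totalDegree_le_of_linear_recursion hf hq0 hq (j + 1 - ℓ) (by omega)
      omega
    · intro h
      simp at h

end MvPolynomial

/-- With linear forms `f_{ij} = α_{ij}x + β_{ij}y`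
(`1 ≤ j ≤ i ≤ n-1`) satisfying `f_{i1} = x - ξ_i y`, and the recursively defined
polynomials `q_0 = 1`, `q_i = ∑_{ℓ=1}^{i} f_{iℓ} q_{i-ℓ}`: each `q_j` has total
degree exactly `j`, its homogeneous part of degree `j` is `∏_{i=1}^{j}(x - ξ_i y)`,
and its coefficient at `y^j` is `(-1)^j ξ_1 ⋯ ξ_j`. (`x = X 0`, `y = X 1`.) -/
theorem recursive_q_polynomials_leading_part
    (n : ℕ) (hn : 2 ≤ n) (ξ : ℕ → ℂ)
    (f : ℕ → ℕ → MvPolynomial (Fin 2) ℂ) (α β : ℕ → ℕ → ℂ)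
    (hf : ∀ i j : ℕ, 1 ≤ j → j ≤ i → i ≤ n - 1 →
      f i j = MvPolynomial.C (α i j) * MvPolynomial.X 0
            + MvPolynomial.C (β i j) * MvPolynomial.X 1)
    (hf1 : ∀ i : ℕ, 1 ≤ i → i ≤ n - 1 →
      f i 1 = MvPolynomial.X 0 - MvPolynomial.C (ξ i) * MvPolynomial.X 1)
    (q : ℕ → MvPolynomial (Fin 2) ℂ)
    (hq0 : q 0 = 1)
    (hq : ∀ i : ℕ, 1 ≤ i → i ≤ n - 1 → q i = ∑ ℓ ∈ Finset.Icc 1 i, f i ℓ * q (i - ℓ)) :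
    ∀ j : ℕ, j ≤ n - 1 →
      (q j).totalDegree = j ∧
      MvPolynomial.homogeneousComponent j (q j) =
        ∏ i ∈ Finset.Icc 1 j, (MvPolynomial.X 0 - MvPolynomial.C (ξ i) * MvPolynomial.X 1) ∧
      MvPolynomial.coeff (Finsupp.single 0 0 + Finsupp.single 1 j) (q j) =
        (-1) ^ j * ∏ i ∈ Finset.Icc 1 j, ξ i := by
  have hlin : ∀ i j : ℕ, 1 ≤ j → j ≤ i → i ≤ n - 1 → (f i j).IsHomogeneous 1 := by
    intro i j h1 h2 h3
    rw [hf i j h1 h2 h3]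
    exact (MvPolynomial.isHomogeneous_C_mul_X _ _).add (MvPolynomial.isHomogeneous_C_mul_X _ _)
  intro j hj
  have hcomp : MvPolynomial.homogeneousComponent j (q j) =
      ∏ i ∈ Finset.Icc 1 j, (MvPolynomial.X 0 - MvPolynomial.C (ξ i) * MvPolynomial.X 1) := by
    rw [MvPolynomial.homogeneousComponent_of_linear_recursion hlin hq0 hq j hj]
    refine Finset.prod_congr rfl fun i hi => ?_
    obtain ⟨h1, h2⟩ := Finset.mem_Icc.1 hi
    exact hf1 i h1 (h2.trans hj)
  refine ⟨le_antisymm (MvPolynomial.totalDegree_le_of_linear_recursion hlin hq0 hq j hj) ?_,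
    hcomp, ?_⟩
  · by_contra! hlt
    rw [MvPolynomial.homogeneousComponent_eq_zero _ _ hlt] at hcomp
    exact Finset.prod_ne_zero_iff.2
      (fun i _ => MvPolynomial.X_sub_C_mul_X_ne_zero (by decide) (ξ i)) hcomp.symm
  · rw [← MvPolynomial.coeff_single_prod_X_sub_C_mul_X, ← hcomp,
      MvPolynomial.coeff_homogeneousComponent]
    simp
end
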